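/- (Janssen representation of the Gabor operator.) Let γ ∈ L¹(ℝ^d), let g be measurable on ℝ^d with ĝ ∈ L¹(ℝ^d), and let L be an invertible real 2d×2d matrix. Then for all Schwartz functions u, φ on ℝ^d the two series Σ_{κ∈ℤ^{2d}} (u, π_{−Lκ}g)_{L²} ⟨π_{−Lκ}γ, φ⟩ and (1/|det L|) Σ_{κ∈ℤ^{2d}} V_gγ(𝒥L^{−T}κ) ⟨π_{𝒥L^{−T}κ}u, φ⟩ converge (as limits of the partial sums over |κ| ≤ h as h → ∞) and are equal, where ⟨ψ, φ⟩ = ∫ ψ(t) φ(t) dt, (u,h)_{L²} = ∫ u overline{h}, and L^{−T} := (L^{−1})^T. -/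

import Mathlib

open MeasureTheory Matrix Filter
open scoped ENNReal NNReal

noncomputable section

/-- `ℝ^d` with the Euclidean norm. -/
abbrev Euc (d : ℕ) := EuclideanSpace ℝ (Fin d)

/-- Index set for `ℝ^{2d} = ℝ^d × ℝ^d`. -/
abbrev ι2 (d : ℕ) := Sum (Fin d) (Fin d)

/-- Turn a plain vector into a point of Euclidean space. -/
def toE {d : ℕ} (x : Fin d → ℝ) : Euc d := (EuclideanSpace.equiv (Fin d) ℝ).symm x

/-- `e^{2πit}`. -/
def e2 (t : ℝ) : ℂ := Complex.exp (2 * Real.pi * Complex.I * t)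

/-- The dot product `x·ω = ∑ⱼ xⱼωⱼ`. -/
def dotE {d : ℕ} (x y : Euc d) : ℝ := ∑ j, x j * y j

/-- First (time) component of `z = (x,ω) ∈ ℝ^{2d}`. -/
def xpart {d : ℕ} (z : ι2 d → ℝ) : Euc d := toE fun i => z (Sum.inl i)

/-- Second (frequency) component of `z = (x,ω) ∈ ℝ^{2d}`. -/
def wpart {d : ℕ} (z : ι2 d → ℝ) : Euc d := toE fun i => z (Sum.inr i)

/-- The symplectic matrix `𝒥` as a map: `𝒥(x,ω) = (-ω,x)`. -/
def Jmap {d : ℕ} (z : ι2 d → ℝ) : ι2 d → ℝ :=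
  Sum.elim (fun i => -(z (Sum.inr i))) (fun i => z (Sum.inl i))

/-- Time-frequency shift `π_z f(t) = e^{2πi ω·t} f(t-x)` for `z = (x,ω)`. -/
def tfs {d : ℕ} (z : ι2 d → ℝ) (f : Euc d → ℂ) (t : Euc d) : ℂ :=
  e2 (dotE (wpart z) t) * f (t - xpart z)

/-- The short-time Fourier transform
`V_gγ(x,ω) = ∫ γ(t) e^{-2πi ω·t} conj(g(t-x)) dt`. -/
def STFT {d : ℕ} (g γ : Euc d → ℂ) (x ω : Euc d) : ℂ :=
  ∫ t : Euc d, γ t * e2 (-(dotE ω t)) * (starRingEnd ℂ) (g (t - x))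

/-- The vector `Lκ ∈ ℝ^{2d}` for `κ ∈ ℤ^{2d}`. -/
def latV {d : ℕ} (L : Matrix (ι2 d) (ι2 d) ℝ) (κ : ι2 d → ℤ) : ι2 d → ℝ :=
  L.mulVec fun i => (κ i : ℝ)

/-- The dual lattice vector `𝒥 L^{-T} κ ∈ ℝ^{2d}`. -/
def dualV {d : ℕ} (L : Matrix (ι2 d) (ι2 d) ℝ) (κ : ι2 d → ℤ) : ι2 d → ℝ :=
  Jmap ((L⁻¹)ᵀ.mulVec fun i => (κ i : ℝ))

/-- The order `|κ| = ∑ᵢ |κᵢ|` of `κ ∈ ℤ^{2d}`. -/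
def ordκ {d : ℕ} (κ : ι2 d → ℤ) : ℕ := ∑ i, (κ i).natAbs


section Poisson

set_option linter.unusedSectionVars false

variable {ι : Type} [Fintype ι]

/-- integer vectors as real vectors -/
def zc (κ : ι → ℤ) : ι → ℝ := fun i => (κ i : ℝ)

/-- unit cube -/
def cubeQ (ι : Type) : Set (ι → ℝ) :=
  {x | ∀ i, x i ∈ Set.Ioc ((0 : ι → ℝ) i) ((0 : ι → ℝ) i + 1)}

lemma cubeQ_meas : MeasurableSet (cubeQ ι) :=
  MeasurableSet.univ_pi' (fun _ => measurableSet_Ioc)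

lemma cubeQ_vol : (volume : Measure (ι → ℝ)) (cubeQ ι) = 1 := by
  have : cubeQ ι = Set.pi Set.univ (fun _ => Set.Ioc (0:ℝ) 1) := by
    ext x; simp [cubeQ]
  rw [this, Real.volume_pi_Ioc]; simp

lemma hasSum_cubes (f : (ι → ℝ) → ℂ) (hf : Integrable f) :
    HasSum (fun κ : ι → ℤ => ∫ z in cubeQ ι, f (z + zc κ)) (∫ z, f z) := by
  set s : (ι → ℤ) → Set (ι → ℝ) := fun κ => {x | x - zc κ ∈ cubeQ ι} with hs
  have hms : ∀ κ, MeasurableSet (s κ) := fun κ =>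
    (measurable_id.sub_const (zc κ)) cubeQ_meas
  have hU : (⋃ κ, s κ) = Set.univ := by
    ext x
    simp only [Set.mem_iUnion, Set.mem_univ, iff_true]
    refine ⟨fun i => ⌈x i⌉ - 1, fun i => ?_⟩
    have h1 := Int.ceil_lt_add_one (x i)
    have h2 := Int.le_ceil (x i)
    simp only [zc, Pi.sub_apply, Pi.zero_apply, Set.mem_Ioc]
    push_cast
    constructor <;> linarith
  have hd : Pairwise (Function.onFun Disjoint s) := by
    intro κ κ' hne
    rw [Function.onFun, Set.disjoint_left]
    intro x hx hx'
    apply hne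
    funext i
    have h1 := hx i
    have h2 := hx' i
    simp only [zc, Pi.sub_apply, Pi.zero_apply, Set.mem_Ioc] at h1 h2
    have a1 : (κ i : ℝ) < κ' i + 1 := by linarith
    have a2 : (κ' i : ℝ) < κ i + 1 := by linarith
    have b1 : κ i < κ' i + 1 := by exact_mod_cast a1
    have b2 : κ' i < κ i + 1 := by exact_mod_cast a2
    omega
  have h := hasSum_integral_iUnion (f := f) (μ := volume) hms hd hf.integrableOn
  rw [hU, setIntegral_univ] at h
  suffices hk : (fun κ : ι → ℤ => ∫ z in cubeQ ι, f (z + zc κ)) = fun κ => ∫ z in s κ, f z by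
    rw [hk]; exact h
  funext κ
  have := (measurePreserving_add_right (volume : Measure (ι → ℝ)) (zc κ)).setIntegral_preimage_emb
    (MeasurableEquiv.addRight (zc κ)).measurableEmbedding f (s κ)
  rw [← this]
  congr 2
  ext x
  simp [hs]

/-- decay weight -/
def rho (N : ℕ) (z : ι → ℝ) : ℝ := ((1 + ‖z‖) ^ N)⁻¹

lemma rho_nonneg (N : ℕ) (z : ι → ℝ) : 0 ≤ rho N z := by unfold rho; positivity

lemma rho_int (N : ℕ) (hN : Fintype.card ι < N) : Integrable (rho (ι := ι) N) := by
  have := integrable_one_add_norm (E := ι → ℝ) (μ := volume) (r := (N : ℝ)) (by simpa using hN)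
  refine this.congr (Eventually.of_forall fun z => ?_)
  simp only [rho]
  rw [Real.rpow_neg (by positivity), Real.rpow_natCast]

lemma rho_add_le (N : ℕ) (z a : ι → ℝ) (R : ℝ) (ha : ‖a‖ ≤ R) :
    rho N (z + a) ≤ (1 + R) ^ N * rho N z := by
  have h0 : 0 ≤ R := (norm_nonneg _).trans ha
  unfold rho
  rw [← div_eq_mul_inv, inv_eq_one_div, div_le_div_iff₀ (by positivity) (by positivity), one_mul,
    ← mul_pow]
  apply pow_le_pow_left₀ (by positivity)
  have : ‖z‖ ≤ ‖z + a‖ + ‖a‖ := by simpa using norm_sub_le (z + a) a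
  nlinarith [norm_nonneg (z + a)]

lemma norm_cubeQ {z : ι → ℝ} (hz : z ∈ cubeQ ι) : ‖z‖ ≤ 1 := by
  rw [pi_norm_le_iff_of_nonneg zero_le_one]
  intro i
  have := hz i
  simp only [Pi.zero_apply, Set.mem_Ioc, zero_add] at this
  rw [Real.norm_eq_abs, abs_le]; constructor <;> linarith

lemma sum_rho_le (N : ℕ) (hN : Fintype.card ι < N) (v : ι → ℝ) (s : Finset (ι → ℤ)) :
    ∑ κ ∈ s, rho N (zc κ + v) ≤ 2 ^ N * ∫ z : ι → ℝ, rho N z := by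
  have hi := rho_int (ι := ι) N hN
  have hi' : Integrable (fun z : ι → ℝ => rho N (z + v)) := hi.comp_add_right v
  have h := hasSum_cubes (fun z : ι → ℝ => ((rho N (z + v) : ℝ) : ℂ)) hi'.ofReal
  simp only [integral_complex_ofReal] at h
  rw [Complex.hasSum_ofReal] at h
  rw [integral_add_right_eq_self (fun z : ι → ℝ => rho N z) v] at h
  have h2 := sum_le_hasSum s (fun κ _ => integral_nonneg fun z => rho_nonneg N _) h
  refine le_trans ?_ (mul_le_mul_of_nonneg_left h2 (by positivity))
  rw [Finset.mul_sum]
  refine Finset.sum_le_sum fun κ _ => ?_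
  rw [← integral_const_mul]
  have h3 : ∫ z in cubeQ ι, rho N (zc κ + v) = rho N (zc κ + v) := by
    simp [cubeQ_vol, Measure.real]
  rw [← h3]
  refine setIntegral_mono_on ?_ ?_ cubeQ_meas ?_
  · exact integrableOn_const (by simp [cubeQ_vol])
  · exact ((hi.comp_add_right (zc κ + v)).const_mul (2 ^ N)).integrableOn.congr_fun
      (fun z _ => by simp [add_assoc]) cubeQ_meas
  · intro z hz
    have := rho_add_le N (z + zc κ + v) (-z) 1 (by simpa using norm_cubeQ hz)
    have e : z + zc κ + v + -z = zc κ + v := by abel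
    rw [e] at this
    norm_num at this
    exact this

lemma summable_rho (N : ℕ) (hN : Fintype.card ι < N) (v : ι → ℝ) :
    Summable fun κ : ι → ℤ => rho N (zc κ + v) :=
  summable_of_sum_le (fun _ => rho_nonneg N _) (sum_rho_le N hN v)

/-- the torus projection -/
def tproj (z : ι → ℝ) : UnitAddTorus ι := fun i => (z i : UnitAddCircle)

lemma tproj_quot : IsOpenQuotientMap (tproj (ι := ι)) :=
  IsOpenQuotientMap.piMap (f := fun (_ : ι) (x : ℝ) => (x : UnitAddCircle))
    (fun _ => QuotientAddGroup.isOpenQuotientMap_mk)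

lemma tproj_eq {z z' : ι → ℝ} (h : tproj z = tproj z') : ∃ κ : ι → ℤ, z' = z + zc κ := by
  have : ∀ i, ∃ n : ℤ, z' i = z i + n := by
    intro i
    have h1 := congrFun h i
    simp only [tproj] at h1
    have h2 := (QuotientAddGroup.eq (s := AddSubgroup.zmultiples (1:ℝ))).1 h1
    obtain ⟨n, hn⟩ := AddSubgroup.mem_zmultiples_iff.1 h2
    refine ⟨n, ?_⟩
    simp at hn
    linarith
  choose κ hκ using this
  exact ⟨κ, funext hκ⟩

lemma mFourier_tproj (n : ι → ℤ) (z : ι → ℝ) :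
    UnitAddTorus.mFourier n (tproj z) = e2 (∑ i, n i * z i) := by
  simp only [UnitAddTorus.mFourier, ContinuousMap.coe_mk, tproj, fourier_coe_apply, e2,
    ← Complex.exp_sum]
  congr 1
  push_cast
  rw [Finset.mul_sum]
  refine Finset.sum_congr rfl fun i _ => ?_
  ring

lemma e2_norm (t : ℝ) : ‖e2 t‖ = 1 := by
  unfold e2
  rw [Complex.norm_exp]; simp

lemma e2_cont : Continuous e2 := by unfold e2; fun_prop

lemma e2_add (s t : ℝ) : e2 (s + t) = e2 s * e2 t := by
  unfold e2; rw [← Complex.exp_add]; push_cast; ring_nf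

lemma e2_int (n : ℤ) : e2 n = 1 := by
  unfold e2
  rw [Complex.exp_eq_one_iff]; exact ⟨n, by push_cast; ring⟩

lemma e2_zero : e2 0 = 1 := by simpa using e2_int 0

lemma e2_conj (t : ℝ) : (starRingEnd ℂ) (e2 t) = e2 (-t) := by
  unfold e2; rw [← Complex.exp_conj]; congr 1; simp [Complex.conj_ofNat]

theorem poisson_std (N : ℕ) (hN : Fintype.card ι < N) (f : (ι → ℝ) → ℂ) (hf : Continuous f)
    (C : ℝ) (hC : ∀ z, ‖f z‖ ≤ C * rho N z)
    (hs : Summable fun κ : ι → ℤ => ∫ z, e2 (-∑ i, zc κ i * z i) * f z) :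
    HasSum (fun κ : ι → ℤ => f (zc κ)) (∑' κ : ι → ℤ, ∫ z, e2 (-∑ i, zc κ i * z i) * f z) := by
  have hfi : Integrable f := ((rho_int N hN).const_mul C).mono' hf.aestronglyMeasurable
    (Eventually.of_forall hC)
  have hC0 : 0 ≤ C := by
    have := (norm_nonneg _).trans (hC 0)
    simpa [rho] using this
  have hsum : ∀ z, Summable fun κ : ι → ℤ => f (z + zc κ) := fun z =>
    Summable.of_norm_bounded ((summable_rho N hN z).mul_left C)
      (fun κ => by simpa [add_comm] using hC (z + zc κ))
  set P : (ι → ℝ) → ℂ := fun z => ∑' κ : ι → ℤ, f (z + zc κ) with hP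
  have hPper : ∀ z (κ : ι → ℤ), P (z + zc κ) = P z := by
    intro z κ
    simp only [hP]
    rw [← (Equiv.addLeft κ).tsum_eq (fun κ' : ι → ℤ => f (z + zc κ'))]
    congr 1; funext κ'
    congr 1
    funext i
    simp [zc]; ring
  have hPc : Continuous P := by
    rw [continuous_iff_continuousAt]
    intro z0
    have : ContinuousOn P (Metric.ball z0 1) := by
      refine continuousOn_tsum (u := fun κ : ι → ℤ => C * ((1 + 1) ^ N * rho N (zc κ + z0)))
        (fun κ => by fun_prop) (((summable_rho N hN z0).mul_left _).mul_left C) ?_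
      intro κ z hz
      refine (hC _).trans (mul_le_mul_of_nonneg_left ?_ hC0)
      have h1 := rho_add_le N (zc κ + z0) (z - z0) 1 (by
        rw [← dist_eq_norm]; exact (Metric.mem_ball.1 hz).le)
      have e : zc κ + z0 + (z - z0) = z + zc κ := by abel
      rwa [e] at h1
    exact this.continuousAt (Metric.ball_mem_nhds _ one_pos)
  let PT : UnitAddTorus ι → ℂ := fun t => P (Function.surjInv tproj_quot.surjective t)
  have hPT : ∀ z, PT (tproj z) = P z := by
    intro z
    obtain ⟨κ, hκ⟩ := tproj_eq (Function.surjInv_eq tproj_quot.surjective (tproj z))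
    show P _ = P z
    conv_rhs => rw [hκ]
    rw [hPper]
  have hPTc : Continuous PT := by
    rw [tproj_quot.isQuotientMap.continuous_iff]
    convert hPc using 1
    funext z; exact hPT z
  let F : C(UnitAddTorus ι, ℂ) := ⟨PT, hPTc⟩
  have hcoef : ∀ κ : ι → ℤ, UnitAddTorus.mFourierCoeff F κ =
      ∫ z, e2 (-∑ i, zc κ i * z i) * f z := by
    intro n
    rw [UnitAddTorus.mFourierCoeff_eq_integral F n 0]
    set φ : (ι → ℝ) → ℂ := fun z => e2 (-∑ i, zc n i * z i) * f z with hφ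
    have hφc : Continuous φ := by
      have := e2_cont
      simp only [hφ]; fun_prop
    have hφn : ∀ z, ‖φ z‖ = ‖f z‖ := fun z => by simp [hφ, e2_norm]
    have hφi : Integrable φ := hfi.mono hφc.aestronglyMeasurable
      (Eventually.of_forall fun z => (hφn z).le)
    have key := hasSum_cubes φ hφi
    have h2 : HasSum (fun κ : ι → ℤ => ∫ z in cubeQ ι, φ (z + zc κ))
        (∫ z in cubeQ ι, ∑' κ : ι → ℤ, φ (z + zc κ)) := by
      apply hasSum_integral_of_summable_integral_norm
      · intro κ; exact (hφi.comp_add_right (zc κ)).integrableOn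
      · simp only [hφn]
        have := hasSum_cubes (fun z => ((‖f z‖ : ℝ) : ℂ)) hfi.norm.ofReal
        simp only [integral_complex_ofReal] at this
        rw [Complex.hasSum_ofReal] at this
        exact this.summable
    rw [← h2.unique key]
    show ∫ z in cubeQ ι, UnitAddTorus.mFourier (-n) (tproj z) • PT (tproj z) = _
    refine integral_congr_ae (Eventually.of_forall fun z => ?_)
    simp only [hPT, mFourier_tproj, smul_eq_mul, hP, hφ]
    rw [← tsum_mul_left]
    congr 1; funext κ
    congr 1
    have e : (-∑ i, zc n i * (z + zc κ) i)
        = (∑ i, (((-n) i : ℤ) : ℝ) * z i) + ((-∑ i, n i * κ i : ℤ) : ℝ) := by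
      push_cast
      simp [zc, mul_add, Finset.sum_add_distrib]; ring
    rw [e, e2_add, e2_int, mul_one]
  have hmain := UnitAddTorus.hasSum_mFourier_series_apply_of_summable (f := F)
    (by simpa only [funext hcoef] using hs) (tproj 0)
  have hz : ∀ κ : ι → ℤ, UnitAddTorus.mFourier κ (tproj (0 : ι → ℝ)) = 1 := by
    intro κ; rw [mFourier_tproj]; simp [e2_zero]
  simp only [hz, hcoef, smul_eq_mul, mul_one] at hmain
  rw [hmain.tsum_eq]
  show HasSum _ (PT (tproj 0))
  rw [hPT]
  have := (hsum 0).hasSum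
  simpa [hP] using this

end Poisson

section Abs

set_option linter.unusedSectionVars false

variable {ι : Type} [Fintype ι] [DecidableEq ι]

lemma hasSum_dom (m : (ι → ℝ) → ℂ) (hm : Integrable m) (a : (ι → ℤ) → (ι → ℝ) → ℂ)
    (ha : ∀ κ, Continuous (a κ)) (B : ℝ) (hB : ∀ w (s : Finset (ι → ℤ)), ∑ κ ∈ s, ‖a κ w‖ ≤ B)
    (S : (ι → ℝ) → ℂ) (hS : ∀ w, HasSum (fun κ => a κ w) (S w)) :
    HasSum (fun κ => ∫ w, m w * a κ w) (∫ w, m w * S w) := by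
  have hB1 : ∀ κ w, ‖a κ w‖ ≤ B := fun κ w => by simpa using hB w {κ}
  have hi : ∀ κ, Integrable (fun w => m w * a κ w) := fun κ =>
    hm.mul_bdd (c := B) (ha κ).aestronglyMeasurable (Eventually.of_forall (hB1 κ))
  have key : Tendsto (fun s : Finset (ι → ℤ) => ∫ w, ∑ κ ∈ s, m w * a κ w) atTop
      (nhds (∫ w, m w * S w)) := by
    refine tendsto_integral_filter_of_dominated_convergence (fun w => ‖m w‖ * B) ?_ ?_ ?_ ?_
    · exact Eventually.of_forall fun s =>
        (integrable_finsetSum s (fun κ _ => hi κ)).aestronglyMeasurable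
    · refine Eventually.of_forall fun s => Eventually.of_forall fun w => ?_
      rw [← Finset.mul_sum, norm_mul]
      exact mul_le_mul_of_nonneg_left ((norm_sum_le _ _).trans (hB w s)) (norm_nonneg _)
    · exact hm.norm.mul_const B
    · exact Eventually.of_forall fun w => (hS w).mul_left (m w)
  have e : (fun s : Finset (ι → ℤ) => ∫ w, ∑ κ ∈ s, m w * a κ w)
      = fun s => ∑ κ ∈ s, ∫ w, m w * a κ w := by
    funext s; exact integral_finsetSum s (fun κ _ => hi κ)
  rw [e] at key
  simpa [HasSum] using key

lemma mulVec_bound (A : Matrix ι ι ℝ) : ∃ M : ℝ, 1 ≤ M ∧ ∀ y, ‖A *ᵥ y‖ ≤ M * ‖y‖ := by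
  let T := (Matrix.toLin' A).toContinuousLinearMap
  refine ⟨max 1 ‖T‖, le_max_left _ _, fun y => ?_⟩
  have := T.le_opNorm y
  refine le_trans ?_ (mul_le_mul_of_nonneg_right (le_max_right 1 ‖T‖) (norm_nonneg _))
  simpa [T] using this

lemma rho_mulVec (A : Matrix ι ι ℝ) : ∃ M : ℝ, 1 ≤ M ∧ ∀ (N : ℕ) y,
    rho N y ≤ M ^ N * rho N (A *ᵥ y) := by
  obtain ⟨M, hM, h⟩ := mulVec_bound A
  refine ⟨M, hM, fun N y => ?_⟩
  unfold rho
  rw [← div_eq_mul_inv, inv_eq_one_div, div_le_div_iff₀ (by positivity) (by positivity), one_mul,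
    ← mul_pow]
  apply pow_le_pow_left₀ (by positivity)
  nlinarith [h y, norm_nonneg y]

/-- Fourier transform on `ι → ℝ`. -/
def ftP (K : (ι → ℝ) → ℂ) (η : ι → ℝ) : ℂ := ∫ z, e2 (-(η ⬝ᵥ z)) * K z

lemma ftP_shift (K : (ι → ℝ) → ℂ) (hK : Continuous K) (L : Matrix ι ι ℝ) (hL : IsUnit L.det)
    (w : ι → ℝ) (k : ι → ℝ) :
    ftP (fun z => K (L *ᵥ z - w)) k =
      ((1 / |L.det| : ℝ) : ℂ) * (ftP K ((L⁻¹)ᵀ *ᵥ k) * e2 (-(((L⁻¹)ᵀ *ᵥ k) ⬝ᵥ w))) := by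
  set η := (L⁻¹)ᵀ *ᵥ k with hη
  have hdot : ∀ z, k ⬝ᵥ z = η ⬝ᵥ (L *ᵥ z) := by
    intro z
    rw [hη, Matrix.mulVec_transpose, ← Matrix.dotProduct_mulVec, Matrix.mulVec_mulVec,
      Matrix.nonsing_inv_mul _ hL, Matrix.one_mulVec]
  set h : (ι → ℝ) → ℂ := fun y => e2 (-(η ⬝ᵥ y)) * K (y - w) with hh
  have hdc : Continuous fun y : ι → ℝ => η ⬝ᵥ y := by unfold dotProduct; fun_prop
  have hc : Continuous h := by
    have := e2_cont
    simp only [hh]; fun_prop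
  have e1 : ftP (fun z => K (L *ᵥ z - w)) k = ∫ z, h (L *ᵥ z) := by
    unfold ftP; simp only [hdot, hh]
  have hmap := Real.map_matrix_volume_pi_eq_smul_volume_pi hL.ne_zero
  have e2' : ∫ z, h (L *ᵥ z) = ∫ y, h y ∂(Measure.map (Matrix.toLin' L) volume) := by
    rw [integral_map]
    · simp
    · exact (LinearMap.continuous_of_finiteDimensional _).aemeasurable
    · exact hc.aestronglyMeasurable
  rw [e1, e2', hmap, integral_smul_measure, ← integral_add_right_eq_self h w]
  have e3 : ∫ y, h (y + w) = ftP K η * e2 (-(η ⬝ᵥ w)) := by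
    unfold ftP
    rw [← integral_mul_const]
    congr 1; funext y
    simp only [hh, add_sub_cancel_right, dotProduct_add, neg_add, e2_add]
    ring
  rw [e3, ENNReal.toReal_ofReal (abs_nonneg _), abs_inv, Complex.real_smul, one_div]

theorem janssen_abs (N : ℕ) (hN : Fintype.card ι < N) (K : (ι → ℝ) → ℂ) (hK : Continuous K)
    (C : ℝ) (hC : ∀ z, ‖K z‖ ≤ C * rho N z) (L : Matrix ι ι ℝ) (hL : IsUnit L.det)
    (hs : Summable fun κ : ι → ℤ => ftP K ((L⁻¹)ᵀ *ᵥ zc κ))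
    (m : (ι → ℝ) → ℂ) (hm : Integrable m) :
    ∃ c, HasSum (fun κ : ι → ℤ => ∫ w, m w * K (L *ᵥ zc κ - w)) c ∧
      HasSum (fun κ : ι → ℤ => ((1 / |L.det| : ℝ) : ℂ) *
        (ftP K ((L⁻¹)ᵀ *ᵥ zc κ) * ftP m ((L⁻¹)ᵀ *ᵥ zc κ))) c := by
  have hC0 : 0 ≤ C := by
    have := (norm_nonneg _).trans (hC 0)
    simpa [rho] using this
  obtain ⟨M, hM, hMr⟩ := rho_mulVec (L⁻¹)
  have hKL : ∀ w z, ‖K (L *ᵥ z - w)‖ ≤ C * M ^ N * rho N (z + -(L⁻¹ *ᵥ w)) := by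
    intro w z
    refine (hC _).trans ?_
    rw [mul_assoc]
    refine mul_le_mul_of_nonneg_left ?_ hC0
    refine (hMr N _).trans_eq ?_
    rw [Matrix.mulVec_sub, Matrix.mulVec_mulVec, Matrix.nonsing_inv_mul _ hL, Matrix.one_mulVec,
      sub_eq_add_neg]
  have hcont : ∀ w, Continuous fun z => K (L *ᵥ z - w) := fun w => by fun_prop
  set D : ℂ := ((1 / |L.det| : ℝ) : ℂ) with hD
  set a : (ι → ℤ) → (ι → ℝ) → ℂ := fun κ w =>
    D * (ftP K ((L⁻¹)ᵀ *ᵥ zc κ) * e2 (-(((L⁻¹)ᵀ *ᵥ zc κ) ⬝ᵥ w))) with ha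
  have hna : ∀ κ w, ‖a κ w‖ = ‖D * ftP K ((L⁻¹)ᵀ *ᵥ zc κ)‖ := fun κ w => by
    simp [ha, e2_norm]
  have hsn : Summable fun κ : ι → ℤ => ‖D * ftP K ((L⁻¹)ᵀ *ᵥ zc κ)‖ := (hs.mul_left D).norm
  have hsa : ∀ w, Summable fun κ => a κ w := fun w =>
    Summable.of_norm (by simpa only [hna] using hsn)
  have hP : ∀ w, HasSum (fun κ : ι → ℤ => K (L *ᵥ zc κ - w)) (∑' κ, a κ w) := by
    intro w
    have e : ∀ κ : ι → ℤ, (∫ z, e2 (-∑ i, zc κ i * z i) * K (L *ᵥ z - w)) = a κ w := fun κ =>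
      ftP_shift K hK L hL w (zc κ)
    have := poisson_std N hN (fun z => K (L *ᵥ z - w)) (hcont w)
      (C * M ^ N * (1 + ‖-(L⁻¹ *ᵥ w)‖) ^ N) (fun z => by
        refine (hKL w z).trans ?_
        rw [mul_assoc (C * M ^ N)]
        exact mul_le_mul_of_nonneg_left (rho_add_le N z _ _ le_rfl) (by positivity))
      (by simp only [e]; exact hsa w)
    simpa only [e] using this
  refine ⟨∫ w, m w * ∑' κ, a κ w, ?_, ?_⟩
  · refine hasSum_dom m hm (fun κ w => K (L *ᵥ zc κ - w)) (fun κ => by fun_prop)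
      (C * M ^ N * (2 ^ N * ∫ z : ι → ℝ, rho N z)) ?_ _ hP
    intro w s
    refine (Finset.sum_le_sum fun κ _ => hKL w (zc κ)).trans ?_
    rw [← Finset.mul_sum]
    exact mul_le_mul_of_nonneg_left (sum_rho_le N hN _ s) (by positivity)
  · have := hasSum_dom m hm a (fun κ => by
        have := e2_cont
        have hdc : Continuous fun y : ι → ℝ => ((L⁻¹)ᵀ *ᵥ zc κ) ⬝ᵥ y := by
          unfold dotProduct; fun_prop
        simp only [ha]; fun_prop)
      (∑' κ : ι → ℤ, ‖D * ftP K ((L⁻¹)ᵀ *ᵥ zc κ)‖) (fun w s => by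
        simp only [hna]
        exact hsn.sum_le_tsum s (fun _ _ => norm_nonneg _))
      (fun w => ∑' κ, a κ w) (fun w => (hsa w).hasSum)
    convert this using 1
    funext κ
    rw [← mul_assoc, show ftP m ((L⁻¹)ᵀ *ᵥ zc κ) = ∫ w, e2 (-(((L⁻¹)ᵀ *ᵥ zc κ) ⬝ᵥ w)) * m w from rfl,
      ← integral_const_mul]
    congr 1; funext w
    simp only [ha]; ring

end Abs

section App

open scoped FourierTransform

variable {d : ℕ}

lemma dotE_comm (x y : Euc d) : dotE x y = dotE y x := by
  unfold dotE; exact Finset.sum_congr rfl fun i _ => mul_comm _ _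

lemma dotE_add_left (x y z : Euc d) : dotE (x + y) z = dotE x z + dotE y z := by
  unfold dotE; simp [add_mul, Finset.sum_add_distrib]

lemma dotE_neg_left (x z : Euc d) : dotE (-x) z = -dotE x z := by
  unfold dotE; simp

lemma dotE_sub_left (x y z : Euc d) : dotE (x - y) z = dotE x z - dotE y z := by
  rw [sub_eq_add_neg, dotE_add_left, dotE_neg_left]; ring

lemma dotE_add_right (x y z : Euc d) : dotE z (x + y) = dotE z x + dotE z y := by
  unfold dotE; simp [mul_add, Finset.sum_add_distrib]

lemma dotE_neg_right (x z : Euc d) : dotE z (-x) = -dotE z x := by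
  unfold dotE; simp

lemma dotE_sub_right (x y z : Euc d) : dotE z (x - y) = dotE z x - dotE z y := by
  rw [sub_eq_add_neg, dotE_add_right, dotE_neg_right]; ring

lemma dotE_inner (x y : Euc d) : inner ℝ x y = dotE x y := by
  unfold dotE
  simp [PiLp.inner_apply, mul_comm]

lemma cont_dotE {X : Type*} [TopologicalSpace X] {a b : X → Euc d} (ha : Continuous a)
    (hb : Continuous b) : Continuous fun x => dotE (a x) (b x) := by
  simp only [← dotE_inner]; exact ha.inner hb

lemma fourier_e2 (u : SchwartzMap (Euc d) ℂ) (ξ : Euc d) :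
    (𝓕 u) ξ = ∫ s, u s * e2 (-(dotE ξ s)) := by
  rw [SchwartzMap.fourier_coe, Real.fourier_eq']
  congr 1; funext s
  rw [dotE_inner, dotE_comm s ξ, smul_eq_mul, mul_comm]
  unfold e2
  congr 2; push_cast; ring

lemma fourierInv_e2 (u : SchwartzMap (Euc d) ℂ) (x : Euc d) :
    ∫ ω, (𝓕 u) ω * e2 (dotE x ω) = u x := by
  have h : (𝓕⁻ (𝓕 u)) x = u x := by rw [FourierTransform.fourierInv_fourier_eq]
  rw [SchwartzMap.fourierInv_coe, Real.fourierInv_eq'] at h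
  rw [← h]
  congr 1; funext s
  rw [dotE_inner, dotE_comm s x, smul_eq_mul, mul_comm]
  unfold e2
  congr 2; push_cast; ring

lemma schwartz_bd (f : SchwartzMap (Euc d) ℂ) (N : ℕ) :
    ∃ C, 0 ≤ C ∧ ∀ x, ‖f x‖ ≤ C * ((1 + ‖x‖) ^ N)⁻¹ := by
  refine ⟨2 ^ N * ((Finset.Iic ((N, 0) : ℕ × ℕ)).sup
    fun m => SchwartzMap.seminorm ℂ m.1 m.2) f, by positivity, fun x => ?_⟩
  have := SchwartzMap.one_add_le_sup_seminorm_apply (𝕜 := ℂ) (m := (N, 0)) (k := N) (n := 0)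
    le_rfl le_rfl f x
  simp only [norm_iteratedFDeriv_zero] at this
  rw [← div_eq_mul_inv, le_div_iff₀ (by positivity), mul_comm]
  exact this

lemma schwartz_conv (f h : SchwartzMap (Euc d) ℂ) (N : ℕ) :
    ∃ C, 0 ≤ C ∧ ∀ a, ∫ x, ‖f x‖ * ‖h (x + a)‖ ≤ C * ((1 + ‖a‖) ^ N)⁻¹ := by
  obtain ⟨C1, h1, hf⟩ := schwartz_bd f (N + (d + 1))
  obtain ⟨C2, h2, hh⟩ := schwartz_bd h N
  set W : Euc d → ℝ := fun x => ((1 + ‖x‖) ^ (d + 1))⁻¹ with hW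
  have hWi : Integrable W := by
    have := integrable_one_add_norm (E := Euc d) (μ := volume) (r := ((d + 1 : ℕ) : ℝ))
      (by simp)
    refine this.congr (Eventually.of_forall fun z => ?_)
    simp only [hW]
    rw [Real.rpow_neg (by positivity), Real.rpow_natCast]
  refine ⟨C1 * C2 * ∫ x, W x, by
    have : 0 ≤ ∫ x, W x := integral_nonneg fun x => by simp only [hW, Pi.zero_apply]; positivity
    positivity, fun a => ?_⟩
  have : ∀ x, ‖f x‖ * ‖h (x + a)‖ ≤ (C1 * C2 * ((1 + ‖a‖) ^ N)⁻¹) * W x := by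
    intro x
    refine (mul_le_mul (hf x) (hh (x + a)) (norm_nonneg _) (by positivity)).trans ?_
    have k : ((1 + ‖x‖) ^ N)⁻¹ * ((1 + ‖x + a‖) ^ N)⁻¹ ≤ ((1 + ‖a‖) ^ N)⁻¹ := by
      rw [← mul_inv, ← mul_pow]
      apply inv_anti₀ (by positivity)
      apply pow_le_pow_left₀ (by positivity)
      have : ‖a‖ ≤ ‖x + a‖ + ‖x‖ := by simpa using norm_sub_le (x + a) x
      nlinarith [norm_nonneg x, norm_nonneg (x + a)]
    have hW0 : 0 ≤ W x := by simp only [hW]; positivity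
    calc C1 * ((1 + ‖x‖) ^ (N + (d + 1)))⁻¹ * (C2 * ((1 + ‖x + a‖) ^ N)⁻¹)
        = C1 * C2 * (((1 + ‖x‖) ^ N)⁻¹ * ((1 + ‖x + a‖) ^ N)⁻¹) * W x := by
          rw [pow_add, mul_inv]; ring
      _ ≤ _ := by gcongr
  refine (integral_mono_of_nonneg (Eventually.of_forall fun x => by positivity)
    (hWi.const_mul _) (Eventually.of_forall this)).trans_eq ?_
  rw [integral_const_mul]; ring

/-- splitting `z = (x, ω)`. -/
def spl (z : ι2 d → ℝ) : Euc d × Euc d := (xpart z, wpart z)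

/-- splitting as a measurable equivalence -/
def splE (d : ℕ) : (ι2 d → ℝ) ≃ᵐ Euc d × Euc d :=
  (MeasurableEquiv.sumPiEquivProdPi (fun _ : ι2 d => ℝ)).trans
    (MeasurableEquiv.prodCongr (MeasurableEquiv.toLp 2 (Fin d → ℝ))
      (MeasurableEquiv.toLp 2 (Fin d → ℝ)))

lemma splE_coe : ⇑(splE d) = spl := rfl

lemma splE_mp : MeasurePreserving (splE d) volume (volume.prod volume) :=
  (volume_measurePreserving_sumPiEquivProdPi (fun _ : ι2 d => ℝ)).trans
    ((PiLp.volume_preserving_toLp (Fin d)).prod (PiLp.volume_preserving_toLp (Fin d)))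

lemma integral_spl (H : Euc d × Euc d → ℂ) :
    ∫ z : ι2 d → ℝ, H (xpart z, wpart z) = ∫ p, H p ∂(volume.prod volume) :=
  splE_mp.integral_comp (splE d).measurableEmbedding H

lemma xpart_cont : Continuous (xpart (d := d)) := by
  unfold xpart toE; fun_prop

lemma wpart_cont : Continuous (wpart (d := d)) := by
  unfold wpart toE; fun_prop

lemma xpart_sub (z w : ι2 d → ℝ) : xpart (z - w) = xpart z - xpart w := by
  ext i; simp [xpart, toE]

lemma wpart_sub (z w : ι2 d → ℝ) : wpart (z - w) = wpart z - wpart w := by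
  ext i; simp [wpart, toE]

lemma xpart_neg (z : ι2 d → ℝ) : xpart (-z) = -xpart z := by
  ext i; simp [xpart, toE]

lemma wpart_neg (z : ι2 d → ℝ) : wpart (-z) = -wpart z := by
  ext i; simp [wpart, toE]

lemma xpart_J (z : ι2 d → ℝ) : xpart (Jmap z) = -wpart z := by
  ext i; simp [xpart, wpart, toE, Jmap]

lemma wpart_J (z : ι2 d → ℝ) : wpart (Jmap z) = xpart z := by
  ext i; simp [xpart, wpart, toE, Jmap]

lemma dot_spl (z w : ι2 d → ℝ) :
    z ⬝ᵥ w = dotE (xpart z) (xpart w) + dotE (wpart z) (wpart w) := by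
  simp [dotProduct, Fintype.sum_sum_type, dotE, xpart, wpart, toE]

lemma norm_le_spl (z : ι2 d → ℝ) : ‖z‖ ≤ ‖xpart z‖ ∨ ‖z‖ ≤ ‖wpart z‖ := by
  have hm : ‖z‖ ≤ max ‖xpart z‖ ‖wpart z‖ := by
    rw [pi_norm_le_iff_of_nonneg (le_max_of_le_left (norm_nonneg _))]
    rintro (i | i)
    · exact le_max_of_le_left (by simpa [xpart, toE] using PiLp.norm_apply_le (xpart z) i)
    · exact le_max_of_le_right (by simpa [wpart, toE] using PiLp.norm_apply_le (wpart z) i)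
  exact le_max_iff.1 hm

lemma rho_case (N : ℕ) (z : ι2 d → ℝ) :
    ((1 + ‖xpart z‖) ^ N)⁻¹ ≤ rho N z ∨ ((1 + ‖wpart z‖) ^ N)⁻¹ ≤ rho N z := by
  unfold rho
  rcases norm_le_spl z with h | h
  · left; gcongr
  · right; gcongr

lemma int_phase {f h : Euc d → ℂ} (hf : Integrable f) (hh : Integrable h)
    {θ : Euc d × Euc d → ℝ} (hθ : Continuous θ) :
    Integrable (fun p : Euc d × Euc d => f p.1 * h p.2 * e2 (θ p)) (volume.prod volume) :=
  (hf.mul_prod hh).mul_bdd (c := 1) (e2_cont.comp hθ).aestronglyMeasurable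
    (Eventually.of_forall fun p => (e2_norm _).le)

/-- the kernel -/
def KK (u φ : SchwartzMap (Euc d) ℂ) (z : ι2 d → ℝ) : ℂ :=
  φ (-(xpart z)) * (𝓕 u) (-(wpart z)) * e2 (dotE (wpart z) (xpart z))

/-- the symbol -/
def mm (γ G : Euc d → ℂ) (v : ι2 d → ℝ) : ℂ :=
  γ (xpart v) * (starRingEnd ℂ) (G (wpart v)) * e2 (-(dotE (xpart v) (wpart v)))

lemma KK_cont (u φ : SchwartzMap (Euc d) ℂ) : Continuous (KK u φ) := by
  have h1 := xpart_cont (d := d)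
  have h2 := wpart_cont (d := d)
  have h3 := e2_cont.comp (cont_dotE h2 h1)
  have h4 := φ.continuous
  have h5 := (𝓕 u).continuous
  exact ((h4.comp h1.neg).mul (h5.comp h2.neg)).mul h3

lemma KK_bd (u φ : SchwartzMap (Euc d) ℂ) (N : ℕ) : ∃ C, ∀ z, ‖KK u φ z‖ ≤ C * rho N z := by
  obtain ⟨C1, h1, hf⟩ := schwartz_bd φ N
  obtain ⟨C2, h2, hh⟩ := schwartz_bd (𝓕 u) N
  refine ⟨C1 * C2, fun z => ?_⟩
  have hx := hf (-(xpart z))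
  have hw := hh (-(wpart z))
  rw [norm_neg] at hx hw
  have e : ‖KK u φ z‖ = ‖φ (-(xpart z))‖ * ‖(𝓕 u) (-(wpart z))‖ := by
    simp [KK, e2_norm]
  rw [e]
  refine (mul_le_mul hx hw (norm_nonneg _) (by positivity)).trans ?_
  have i1 : ((1 + ‖xpart z‖) ^ N)⁻¹ ≤ 1 :=
    inv_le_one_of_one_le₀ (one_le_pow₀ (by linarith [norm_nonneg (xpart z)]))
  have i2 : ((1 + ‖wpart z‖) ^ N)⁻¹ ≤ 1 :=
    inv_le_one_of_one_le₀ (one_le_pow₀ (by linarith [norm_nonneg (wpart z)]))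
  have p1 : 0 ≤ ((1 + ‖xpart z‖) ^ N)⁻¹ := by positivity
  have p2 : 0 ≤ ((1 + ‖wpart z‖) ^ N)⁻¹ := by positivity
  have : ((1 + ‖xpart z‖) ^ N)⁻¹ * ((1 + ‖wpart z‖) ^ N)⁻¹ ≤ rho N z := by
    rcases rho_case N z with h | h
    · exact (mul_le_of_le_one_right p1 i2).trans h
    · exact (mul_le_of_le_one_left p2 i1).trans h
  calc _ = C1 * C2 * (((1 + ‖xpart z‖) ^ N)⁻¹ * ((1 + ‖wpart z‖) ^ N)⁻¹) := by ring
    _ ≤ _ := by gcongr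

lemma ftKK_prod (u φ : SchwartzMap (Euc d) ℂ) (η : ι2 d → ℝ) :
    ftP (KK u φ) η = ∫ p : Euc d × Euc d, φ p.1 * (𝓕 u) p.2 *
      e2 (dotE (xpart η) p.1 + dotE (wpart η) p.2 + dotE p.2 p.1) ∂(volume.prod volume) := by
  rw [← integral_spl, ← integral_neg_eq_self, ftP]
  congr 1; funext z
  simp only [KK, xpart_neg, wpart_neg, dot_spl, e2_add, neg_add, dotE_neg_right, dotE_neg_left, neg_neg]
  ring_nf

lemma phase_cont (a b : Euc d) : Continuous fun p : Euc d × Euc d =>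
    dotE a p.1 + dotE b p.2 + dotE p.2 p.1 :=
  ((cont_dotE continuous_const continuous_fst).add
    (cont_dotE continuous_const continuous_snd)).add (cont_dotE continuous_snd continuous_fst)

lemma ftKK_eq (u φ : SchwartzMap (Euc d) ℂ) (η : ι2 d → ℝ) :
    ftP (KK u φ) η = ∫ t, e2 (dotE (xpart η) t) * u (t + wpart η) * φ t := by
  rw [ftKK_prod, integral_prod _ (int_phase φ.integrable (𝓕 u).integrable (phase_cont _ _))]
  congr 1; funext x
  rw [← fourierInv_e2 u (x + wpart η), ← integral_const_mul, ← integral_mul_const]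
  congr 1; funext ω
  simp only [e2_add, dotE_add_left, dotE_comm ω x]
  ring

lemma ftKK_eq' (u φ : SchwartzMap (Euc d) ℂ) (η : ι2 d → ℝ) :
    ftP (KK u φ) η = ∫ ω, (𝓕 u) ω * e2 (dotE (wpart η) ω) * (𝓕 φ) (-(ω + xpart η)) := by
  rw [ftKK_prod, integral_prod_symm _ (int_phase φ.integrable (𝓕 u).integrable (phase_cont _ _))]
  congr 1; funext ω
  rw [fourier_e2 φ, ← integral_const_mul]
  congr 1; funext x
  simp only [e2_add, dotE_add_left, dotE_neg_left, neg_neg]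
  ring

lemma ftKK_bd (u φ : SchwartzMap (Euc d) ℂ) (N : ℕ) :
    ∃ C, 0 ≤ C ∧ ∀ η, ‖ftP (KK u φ) η‖ ≤ C * rho N η := by
  obtain ⟨C1, h1, hf⟩ := schwartz_conv φ u N
  obtain ⟨C2, h2, hh⟩ := schwartz_conv (𝓕⁻ u) (𝓕 φ) N
  have hflip : ∀ ω, (𝓕 u) ω = (𝓕⁻ u) (-ω) := by
    intro ω
    rw [SchwartzMap.fourier_coe, SchwartzMap.fourierInv_coe, Real.fourierInv_eq_fourier_neg,
      neg_neg]
  refine ⟨C1 + C2, by positivity, fun η => ?_⟩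
  have b1 : ‖ftP (KK u φ) η‖ ≤ C1 * ((1 + ‖wpart η‖) ^ N)⁻¹ := by
    rw [ftKK_eq]
    refine (norm_integral_le_integral_norm _).trans (le_of_eq_of_le ?_ (hf (wpart η)))
    congr 1; funext t
    simp [e2_norm, mul_comm]
  have b2 : ‖ftP (KK u φ) η‖ ≤ C2 * ((1 + ‖xpart η‖) ^ N)⁻¹ := by
    rw [ftKK_eq']
    have := hh (-(xpart η))
    rw [norm_neg] at this
    refine (norm_integral_le_integral_norm _).trans (le_of_eq_of_le ?_ this)
    rw [← integral_neg_eq_self]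
    congr 1; funext t
    simp only [norm_mul, e2_norm, mul_one, hflip, neg_neg, neg_add]
  have p := rho_nonneg N η
  rcases rho_case N η with h | h
  · exact b2.trans (mul_le_mul (by linarith) h (by positivity) (by positivity))
  · exact b1.trans (mul_le_mul (by linarith) h (by positivity) (by positivity))

lemma ftKK_summable (u φ : SchwartzMap (Euc d) ℂ) (L : Matrix (ι2 d) (ι2 d) ℝ)
    (hL : IsUnit L.det) : Summable fun κ : ι2 d → ℤ => ftP (KK u φ) ((L⁻¹)ᵀ *ᵥ zc κ) := by
  set N := Fintype.card (ι2 d) + 1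
  obtain ⟨C, hC0, hC⟩ := ftKK_bd u φ N
  obtain ⟨M, hM, hMr⟩ := rho_mulVec Lᵀ
  have hs := ((summable_rho (ι := ι2 d) N (Nat.lt_succ_self _) 0).mul_left (C * M ^ N))
  refine Summable.of_norm_bounded hs fun κ => ?_
  refine (hC _).trans ?_
  rw [mul_assoc, add_zero]
  refine mul_le_mul_of_nonneg_left ?_ hC0
  refine (hMr N _).trans_eq ?_
  rw [Matrix.mulVec_mulVec, ← Matrix.transpose_mul, Matrix.nonsing_inv_mul _ hL,
    Matrix.transpose_one, Matrix.one_mulVec]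

lemma conj_int {G : Euc d → ℂ} (hG : Integrable G) :
    Integrable fun ξ => (starRingEnd ℂ) (G ξ) := by
  refine hG.mono (Complex.continuous_conj.comp_aestronglyMeasurable hG.1) ?_
  exact Eventually.of_forall fun x => by simp

lemma mm_int {γ G : Euc d → ℂ} (hγ : Integrable γ) (hG : Integrable G) :
    Integrable (mm γ G) := by
  have := int_phase (θ := fun p => -(dotE p.1 p.2)) hγ (conj_int hG)
    (cont_dotE continuous_fst continuous_snd).neg
  exact (splE_mp.integrable_comp_emb (splE d).measurableEmbedding).2 this

lemma ae_shift {g : Euc d → ℂ} {P : Euc d → ℂ} (h : ∀ᵐ x, g x = P x) (a : Euc d) :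
    ∀ᵐ x, g (x - a) = P (x - a) :=
  (measurePreserving_sub_right volume a).quasiMeasurePreserving.ae h

lemma conj_g (G : Euc d → ℂ) (x : Euc d) :
    (starRingEnd ℂ) (∫ ω, G ω * e2 (dotE x ω)) =
      ∫ ω, (starRingEnd ℂ) (G ω) * e2 (-(dotE x ω)) := by
  rw [← integral_conj]
  congr 1; funext ω
  rw [map_mul, e2_conj]

lemma ftmm_eq {γ g G : Euc d → ℂ} (hγ : Integrable γ) (hG : Integrable G)
    (hginv : ∀ᵐ x : Euc d, g x = ∫ ω : Euc d, G ω * e2 (dotE x ω)) (η : ι2 d → ℝ) :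
    ftP (mm γ G) η = STFT g γ (xpart (Jmap η)) (wpart (Jmap η)) := by
  have e : ftP (mm γ G) η = ∫ p : Euc d × Euc d, γ p.1 * (starRingEnd ℂ) (G p.2) *
      e2 (-(dotE (xpart η) p.1 + dotE (wpart η) p.2 + dotE p.2 p.1)) ∂(volume.prod volume) := by
    rw [← integral_spl, ftP]
    congr 1; funext z
    simp only [mm, dot_spl, e2_add, neg_add, dotE_comm (wpart z) (xpart z)]
    ring
  rw [e, integral_prod _ (int_phase (θ := fun p => -(dotE (xpart η) p.1 + dotE (wpart η) p.2 + dotE p.2 p.1)) hγ (conj_int hG) (phase_cont _ _).neg), STFT]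
  refine integral_congr_ae ?_
  filter_upwards [ae_shift hginv (xpart (Jmap η))] with t ht
  rw [ht, conj_g, ← integral_const_mul]
  congr 1; funext ω
  simp only [xpart_J, wpart_J, dotE_add_left, dotE_neg_left, neg_add, e2_add, sub_neg_eq_add,
    dotE_comm ω t]
  ring

lemma lhs_term {γ g G : Euc d → ℂ} (hG : Integrable G)
    (hginv : ∀ᵐ x : Euc d, g x = ∫ ω : Euc d, G ω * e2 (dotE x ω))
    (u φ : SchwartzMap (Euc d) ℂ) (z : ι2 d → ℝ) :
    ∫ w, mm γ G w * KK u φ (z - w) =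
      (∫ t : Euc d, u t * (starRingEnd ℂ) (tfs (-z) g t)) * ∫ t : Euc d, tfs (-z) γ t * φ t := by
  have e1 : ∫ t : Euc d, tfs (-z) γ t * φ t =
      ∫ y, γ y * φ (y - xpart z) * e2 (dotE (wpart z) (xpart z) - dotE (wpart z) y) := by
    rw [← integral_sub_right_eq_self (fun t => tfs (-z) γ t * φ t) (xpart z)]
    congr 1; funext y
    simp only [tfs, xpart_neg, wpart_neg, sub_neg_eq_add, sub_add_cancel, dotE_neg_left,
      dotE_sub_right]
    ring_nf
  have e2' : ∫ t : Euc d, u t * (starRingEnd ℂ) (tfs (-z) g t) =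
      ∫ ξ, (starRingEnd ℂ) (G ξ) * (𝓕 u) (ξ - wpart z) * e2 (-(dotE ξ (xpart z))) := by
    have s1 : ∫ t : Euc d, u t * (starRingEnd ℂ) (tfs (-z) g t) =
        ∫ t, ∫ ξ, u t * (starRingEnd ℂ) (G ξ) *
          e2 (dotE (wpart z) t - dotE t ξ - dotE (xpart z) ξ) := by
      refine integral_congr_ae ?_
      filter_upwards [ae_shift hginv (xpart (-z))] with t ht
      rw [tfs, ht, map_mul, e2_conj, conj_g, ← integral_const_mul, ← integral_const_mul]
      congr 1; funext ξ
      simp only [xpart_neg, wpart_neg, dotE_add_left, dotE_neg_left, sub_eq_add_neg, neg_add,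
        e2_add, neg_neg]
      ring
    rw [s1, integral_integral_swap]
    · congr 1; funext ξ
      rw [fourier_e2, ← integral_const_mul, ← integral_mul_const]
      congr 1; funext t
      simp only [dotE_sub_left, sub_eq_add_neg, neg_add, e2_add, neg_neg, dotE_comm t ξ,
        dotE_comm (xpart z) ξ, dotE_add_left, dotE_neg_left]
      ring
    · exact int_phase u.integrable (conj_int hG)
        (((cont_dotE continuous_const continuous_fst).sub
          (cont_dotE continuous_fst continuous_snd)).sub
          (cont_dotE continuous_const continuous_snd))
  rw [e1, e2', mul_comm, ← integral_prod_mul, ← integral_spl]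
  congr 1; funext w
  simp only [mm, KK, xpart_sub, wpart_sub, neg_sub, dotE_sub_left, dotE_sub_right]
  have ph : e2 (-(dotE (xpart w) (wpart w))) *
      e2 (dotE (wpart z) (xpart z) - dotE (wpart w) (xpart z) -
        (dotE (wpart z) (xpart w) - dotE (wpart w) (xpart w))) =
      e2 (dotE (wpart z) (xpart z) - dotE (wpart z) (xpart w)) *
        e2 (-(dotE (wpart w) (xpart z))) := by
    rw [← e2_add, ← e2_add, dotE_comm (xpart w) (wpart w)]
    congr 1; ring
  have ph' := congrArg (fun c => γ (xpart w) * (starRingEnd ℂ) (G (wpart w)) *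
    φ (xpart w - xpart z) * (𝓕 u) (wpart w - wpart z) * c) ph
  linear_combination ph'

lemma hasSum_balls {f : (ι2 d → ℤ) → ℂ} {c : ℂ} (hf : HasSum f c) :
    Tendsto (fun h : ℕ => ∑' κ : {κ : ι2 d → ℤ // ordκ κ ≤ h}, f κ.1) atTop (nhds c) := by
  have hfin : ∀ h : ℕ, {κ : ι2 d → ℤ | ordκ κ ≤ h}.Finite := by
    intro h
    refine (Set.finite_Icc (fun _ => -(h : ℤ)) (fun _ => (h : ℤ))).subset fun κ hκ => ?_
    have hi : ∀ i, (κ i).natAbs ≤ h := fun i =>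
      (Finset.single_le_sum (f := fun i => (κ i).natAbs) (fun _ _ => Nat.zero_le _)
        (Finset.mem_univ i)).trans hκ
    constructor
    · intro i; have := hi i; show -(h : ℤ) ≤ κ i; omega
    · intro i; have := hi i; show κ i ≤ (h : ℤ); omega
  have hS : Tendsto (fun h => (hfin h).toFinset) atTop atTop := by
    apply tendsto_atTop_finset_of_monotone
    · intro a b hab κ hκ
      simp only [Set.Finite.mem_toFinset, Set.mem_setOf_eq] at hκ ⊢
      omega
    · intro κ; exact ⟨ordκ κ, by simp⟩
  have hf' : Tendsto (fun s : Finset (ι2 d → ℤ) => ∑ κ ∈ s, f κ) atTop (nhds c) := by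
    simpa [HasSum] using hf
  refine (hf'.comp hS).congr fun h => ?_
  simp only [Function.comp]
  rw [← Finset.tsum_subtype]
  exact (Equiv.subtypeEquivRight (fun κ => by simp)).tsum_eq
    (fun κ : {κ : ι2 d → ℤ // ordκ κ ≤ h} => f κ.1)

end App

/-- Janssen representation of the Gabor operator: for `γ ∈ L¹(ℝ^d)`,
`g` measurable with `ĝ = G ∈ L¹(ℝ^d)`, `L ∈ GL(2d)` and Schwartz functions `u, φ`,
the series `∑_κ (u, π_{-Lκ}g)_{L²} ⟨π_{-Lκ}γ, φ⟩` and
`(1/|det L|) ∑_κ V_gγ(𝒥L^{-T}κ) ⟨π_{𝒥L^{-T}κ}u, φ⟩` converge (as limits of the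
partial sums over `|κ| ≤ h`) and have the same sum. -/
theorem stmt7 {d : ℕ} (γ g G : Euc d → ℂ)
    (hγ : Integrable γ) (hG : Integrable G)
    (hg_meas : AEStronglyMeasurable g volume)
    (hginv : ∀ᵐ x : Euc d, g x = ∫ ω : Euc d, G ω * e2 (dotE x ω))
    (L : Matrix (ι2 d) (ι2 d) ℝ) (hL : IsUnit L.det)
    (u φ : SchwartzMap (Euc d) ℂ) :
    ∃ c : ℂ,
      Tendsto
        (fun h : ℕ => ∑' κ : {κ : ι2 d → ℤ // ordκ κ ≤ h},
          (∫ t : Euc d, u t * (starRingEnd ℂ) (tfs (-(latV L κ.1)) g t)) *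
            ∫ t : Euc d, tfs (-(latV L κ.1)) γ t * φ t)
        atTop (nhds c)
      ∧ Tendsto
          (fun h : ℕ => ((1 / |L.det| : ℝ) : ℂ) *
            ∑' κ : {κ : ι2 d → ℤ // ordκ κ ≤ h},
              STFT g γ (xpart (dualV L κ.1)) (wpart (dualV L κ.1)) *
                ∫ t : Euc d, tfs (dualV L κ.1) (fun s => u s) t * φ t)
          atTop (nhds c) := by
  obtain ⟨C, hC⟩ := KK_bd u φ (Fintype.card (ι2 d) + 1)
  obtain ⟨c, h1, h2⟩ := janssen_abs (Fintype.card (ι2 d) + 1) (Nat.lt_succ_self _) (KK u φ)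
    (KK_cont u φ) C hC L hL (ftKK_summable u φ L hL) (mm γ G) (mm_int hγ hG)
  refine ⟨c, ?_, ?_⟩
  · have := hasSum_balls h1
    refine this.congr fun h => ?_
    refine tsum_congr fun κ => ?_
    exact lhs_term hG hginv u φ (latV L κ.1)
  · have := hasSum_balls h2
    refine this.congr fun h => ?_
    rw [tsum_mul_left]
    congr 1
    refine tsum_congr fun κ => ?_
    rw [ftmm_eq hγ hG hginv, ftKK_eq, mul_comm]
    simp only [dualV, tfs, xpart_J, wpart_J, sub_neg_eq_add]
    rfl
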